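/- arXiv:1002.4465 — 2 statements merged into one kernel-verified Lean document; each statement's English description precedes it below -/
import Mathlib

section
/- Let f : ℤ → ℤ be a function with f(n) = 0 for all sufficiently large n, and let i, j be integers with 1 ≤ i ≤ j. Then Σ_{n ≥ i−1} C(n, i−1)·Δ^j f(n) = (−1)^i·Δ^{j−i} f(−1), where the sum on the left has only finitely many nonzero terms. (Corollary 4.2(1).) -/
/-- The (backward) difference operator `Δg(n) = g(n) − g(n−1)`. -/
def fdiff (g : ℤ → ℤ) : ℤ → ℤ := fun n => g n - g (n - 1)

theorem fdiff_iter_vanish (f : ℤ → ℤ) (N : ℤ) (h : ∀ n : ℤ, N ≤ n → f n = 0) (k : ℕ) :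
    ∀ n : ℤ, N + k ≤ n → fdiff^[k] f n = 0 := by
  induction k with
  | zero => intro n hn; exact h n (by simpa using hn)
  | succ k ih =>
    intro n hn
    push_cast at hn
    rw [Function.iterate_succ_apply']
    simp only [fdiff]
    rw [ih n (by omega), ih (n - 1) (by omega)]
    simp

theorem fdiff_sum_zero (g : ℤ → ℤ) (P : ℕ) :
    ∑ n ∈ Finset.range (P + 1), fdiff g n = g P - g (-1) := by
  induction P with
  | zero => simp [fdiff]
  | succ P ih => rw [Finset.sum_range_succ, ih]; simp [fdiff]

theorem fdiff_sum_succ (g : ℤ → ℤ) (k P : ℕ) :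
    ∑ n ∈ Finset.range (P + 1), (n.choose (k + 1) : ℤ) * fdiff g n
      = (P.choose (k + 1) : ℤ) * g P - ∑ n ∈ Finset.range P, (n.choose k : ℤ) * g n := by
  induction P with
  | zero => simp
  | succ P ih =>
    rw [Finset.sum_range_succ, ih, Finset.sum_range_succ _ P, Nat.choose_succ_succ P k]
    simp only [fdiff]
    push_cast
    rw [add_sub_cancel_right]
    ring

theorem fdiff_sum_main (g : ℤ → ℤ) (N : ℤ) (h : ∀ n : ℤ, N ≤ n → g n = 0) (k : ℕ) :
    ∀ P : ℕ, N + k ≤ P → k ≤ P →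
      ∑ n ∈ Finset.range (P + 1), (n.choose k : ℤ) * fdiff^[k + 1] g n
        = (-1 : ℤ) ^ (k + 1) * g (-1) := by
  induction k with
  | zero =>
    intro P hP _
    have := fdiff_sum_zero g P
    rw [h P (by simpa using hP)] at this
    simpa using this
  | succ k ih =>
    intro P hP hk
    obtain ⟨Q, rfl⟩ : ∃ Q, P = Q + 1 := ⟨P - 1, by omega⟩
    rw [Function.iterate_succ', Function.comp_apply, fdiff_sum_succ,
      ih Q (by push_cast at hP; omega) (by omega),
      fdiff_iter_vanish g N h (k + 1) _ hP]
    ring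

theorem sum_choose_delta_eq_delta_at_neg_one
    (f : ℤ → ℤ) (hf : ∃ N : ℤ, ∀ n : ℤ, N ≤ n → f n = 0)
    (i j : ℕ) (hi : 1 ≤ i) (hij : i ≤ j) :
    (∑ᶠ n : ℕ, if i - 1 ≤ n then (n.choose (i - 1) : ℤ) * fdiff^[j] f n else 0)
      = (-1 : ℤ) ^ i * fdiff^[j - i] f (-1) := by
  obtain ⟨N, hN⟩ := hf
  obtain ⟨k, rfl⟩ : ∃ k, i = k + 1 := ⟨i - 1, by omega⟩
  obtain ⟨m, rfl⟩ : ∃ m, j = (k + 1) + m := ⟨j - (k + 1), by omega⟩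
  have hg := fdiff_iter_vanish f N hN m
  have hv := fdiff_iter_vanish f N hN (k + 1 + m)
  simp only [Nat.add_sub_cancel, Nat.add_sub_cancel_left]
  rw [← fdiff_sum_main _ _ hg k (N.toNat + m + k + 1) (by push_cast; omega) (by omega)]
  rw [finsum_eq_sum_of_support_subset (s := Finset.range (N.toNat + m + k + 1 + 1))]
  · refine Finset.sum_congr rfl fun n _ => ?_
    rw [← Function.iterate_add_apply]
    split_ifs with h
    · rfl
    · rw [Nat.choose_eq_zero_of_lt (by omega)]; simp
  · intro n hn
    by_contra hc
    apply hn
    simp only [Finset.coe_range, Set.mem_Iio, not_lt] at hc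
    have := hv n (by push_cast; omega)
    simp [this]
end

section
/- Let f : ℤ → ℤ be a function with f(n) = 0 for all sufficiently large n, and let i, j be integers with 1 ≤ i ≤ j. Then Σ_{n ≥ i} C(n−1, i−1)·Δ^j f(n) = (−1)^i·Δ^{j−i} f(0), where the sum on the left has only finitely many nonzero terms. (Corollary 4.2(2).) -/
theorem sum_parts (h : ℤ → ℤ) (k M : ℕ) :
    ∑ m ∈ Finset.range M, ((m.choose (k + 1) : ℕ) : ℤ) * fdiff h ((m : ℤ) + 1)
      = (M.choose (k + 1) : ℕ) * h M
        - ∑ m ∈ Finset.range M, ((m.choose k : ℕ) : ℤ) * h ((m : ℤ) + 1) := by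
  induction M with
  | zero => simp
  | succ M ih =>
    rw [Finset.sum_range_succ, Finset.sum_range_succ, ih, Nat.choose_succ_succ]
    simp only [fdiff, add_sub_cancel_right]
    push_cast
    ring

theorem sum_main (g : ℤ → ℤ) (M k : ℕ) (h : ∀ l ≤ k, fdiff^[l] g M = 0) :
    ∑ m ∈ Finset.range M, ((m.choose k : ℕ) : ℤ) * fdiff^[k + 1] g ((m : ℤ) + 1)
      = (-1) ^ (k + 1) * g 0 := by
  induction k with
  | zero =>
    have := Finset.sum_range_sub (fun m : ℕ => g m) M
    have h0 := h 0 le_rfl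
    simp only [Function.iterate_zero, id] at h0
    simp [fdiff] at this ⊢
    rw [this, h0]; simp
  | succ k ih =>
    rw [Function.iterate_succ_apply' fdiff (k + 1) g, sum_parts, ih (fun l hl => h l (by omega)),
      h (k + 1) le_rfl]
    ring

theorem sum_choose_delta_eq_delta_at_zero
    (f : ℤ → ℤ) (hf : ∃ N : ℤ, ∀ n : ℤ, N ≤ n → f n = 0)
    (i j : ℕ) (hi : 1 ≤ i) (hij : i ≤ j) :
    (∑ᶠ n : ℕ, if i ≤ n then (((n - 1).choose (i - 1) : ℕ) : ℤ) * fdiff^[j] f n else 0)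
      = (-1 : ℤ) ^ i * fdiff^[j - i] f 0 := by
  obtain ⟨N, hN⟩ := hf
  obtain ⟨k, rfl⟩ : ∃ k, i = k + 1 := ⟨i - 1, by omega⟩
  obtain ⟨d, rfl⟩ : ∃ d, j = k + 1 + d := ⟨j - (k + 1), by omega⟩
  have hv := fdiff_iter_vanish f N hN
  set M : ℕ := N.toNat + (k + 1 + d) with hM
  have key := sum_main (fdiff^[d] f) M k (by
    intro l hl
    rw [← Function.iterate_add_apply]
    apply hv
    push_cast
    omega)
  rw [finsum_eq_sum_of_support_subset (s := Finset.range (M + 1)), Finset.sum_range_succ']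
  · simp only [Nat.add_sub_cancel_left, ← key]
    rw [if_neg (by omega), add_zero]
    apply Finset.sum_congr rfl
    intro m _
    rw [← Function.iterate_add_apply]
    split_ifs with hc
    · simp
    · rw [Nat.choose_eq_zero_of_lt (by omega)]; simp
  · intro n hn
    by_contra hc
    apply hn
    simp only [Finset.coe_range, Set.mem_Iio, not_lt] at hc
    have := hv (k + 1 + d) n (by push_cast; omega)
    simp [this]
end
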